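/- arXiv:2405.17847 — 5 statements merged into one kernel-verified Lean document; each statement's English description precedes it below -/
import Mathlib

section
/- Let k ≥ 2 and let T be a k-regular tree with edge length function ℓ and phylogenetic covariance matrix C. Let ψ be a Haar-like wavelet associated with an interior node v ∈ I (i.e., ψ = φ_∘ with v = ∘, or ψ = φ_{v,n} for some v ∈ I∖{∘} and 1 ≤ n < k). Then Cψ = diag(ℓ*(L,v))ψ; that is, for every leaf j ∈ L, ∑_{i∈L} C(j,i) ψ(i) = ℓ*(j,v) ψ(j). -/
/-- A finite rooted tree, encoded by a parent function together with a depth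
function certifying acyclicity and connectivity to the root. -/
structure FinRootedTree where
  V : Type
  fintypeV : Fintype V
  decEqV : DecidableEq V
  root : V
  parent : V → V
  parent_root : parent root = root
  depth : V → ℕ
  depth_eq_zero : ∀ v : V, depth v = 0 ↔ v = root
  depth_parent : ∀ v : V, v ≠ root → depth (parent v) + 1 = depth v

attribute [instance] FinRootedTree.fintypeV FinRootedTree.decEqV

namespace FinRootedTree

variable (T : FinRootedTree)

/-- The children of a vertex. -/
def children (v : T.V) : Finset T.V :=
  Finset.univ.filter fun u => u ≠ T.root ∧ T.parent u = v

/-- A vertex is a leaf when it has no children. -/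
def IsLeaf (v : T.V) : Prop := T.children v = ∅

instance : DecidablePred T.IsLeaf := fun v =>
  decidable_of_iff (T.children v = ∅) Iff.rfl

/-- The set of leaves. -/
def leaves : Finset T.V := Finset.univ.filter fun v => T.IsLeaf v

/-- The set of interior nodes. -/
def interior : Finset T.V := Finset.univ.filter fun v => ¬ T.IsLeaf v

/-- The ancestors of `v`, including `v` itself. -/
def ancSelf (v : T.V) : Finset T.V :=
  (Finset.range (Fintype.card T.V + 1)).image (fun m => T.parent^[m] v)

/-- The edges on the path from `v` to the root; each edge is identified with
its endpoint farther from the root. -/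
def edgesToRoot (v : T.V) : Finset T.V := (T.ancSelf v).erase T.root

/-- The edges on the path between `u` and `v`. -/
def pathEdges (u v : T.V) : Finset T.V :=
  (T.edgesToRoot u \ T.edgesToRoot v) ∪ (T.edgesToRoot v \ T.edgesToRoot u)

/-- The leaves of the subtree rooted at `v`. -/
def leavesBelow (v : T.V) : Finset T.V := T.leaves.filter fun i => v ∈ T.ancSelf i

/-- The phylogenetic covariance matrix: `cov ℓ i j = ∑_{e ∈ [i∧j, ∘]} ℓ(e)`
(the edges from the least common ancestor of `i` and `j` to the root are
exactly the common ancestors of `i` and `j` other than the root). -/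
def cov (ℓ : T.V → ℝ) (i j : T.V) : ℝ :=
  ∑ w ∈ T.edgesToRoot i ∩ T.edgesToRoot j, ℓ w

/-- The trace length `ℓ*(u,v) = ∑_{e ∈ [u,v]} |L(e)| ℓ(e)`. -/
def traceLength (ℓ : T.V → ℝ) (u v : T.V) : ℝ :=
  ∑ w ∈ T.pathEdges u v, ((T.leavesBelow w).card : ℝ) * ℓ w

/-- Internal path length: the sum of the depths of the interior nodes. -/
def IPL : ℕ := ∑ v ∈ T.interior, T.depth v

/-- `T` is `k`-regular: the root has exactly one child and every other
interior node has exactly `k` children. -/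
def IsKRegular (k : ℕ) : Prop :=
  (T.children T.root).card = 1 ∧
    ∀ v : T.V, v ≠ T.root → ¬ T.IsLeaf v → (T.children v).card = k

end FinRootedTree

/-- A `k`-regular structure on a finite rooted tree: an ordering of the
children of each interior non-root node by `{0, …, k-1}` (index `i`
corresponds to the child `v_{i+1}` of the paper), the root having degree
one. -/
structure KRegStruct (k : ℕ) (T : FinRootedTree) where
  child : T.V → ℕ → T.V
  root_deg : (T.children T.root).card = 1
  child_mem : ∀ v : T.V, v ≠ T.root → ¬ T.IsLeaf v → ∀ i < k, child v i ∈ T.children v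
  child_inj : ∀ v : T.V, v ≠ T.root → ¬ T.IsLeaf v →
      ∀ i < k, ∀ j < k, child v i = child v j → i = j
  child_surj : ∀ v : T.V, v ≠ T.root → ¬ T.IsLeaf v →
      ∀ u ∈ T.children v, ∃ i < k, child v i = u

/-- The mother wavelet `φ_∘` of a tree. -/
noncomputable def FinRootedTree.rootWavelet (T : FinRootedTree) : T.V → ℝ :=
  fun _ => 1 / Real.sqrt ((T.leaves.card : ℝ))

/-- The index set of the Haar-like wavelets: the root index `none` together
with the pairs `(v, n)` for `v` an interior non-root node and `1 ≤ n < k`. -/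
def FinRootedTree.waveletIdx (k : ℕ) (T : FinRootedTree) : Finset (Option (T.V × ℕ)) :=
  insert none (((T.interior.erase T.root) ×ˢ Finset.Ico 1 k).image some)

namespace KRegStruct

variable {k : ℕ} {T : FinRootedTree} (R : KRegStruct k T)

/-- `L_{v,n}`: the leaves below the first `n` children of `v`. -/
def Lpart (v : T.V) (n : ℕ) : Finset T.V :=
  (Finset.range n).biUnion fun j => T.leavesBelow (R.child v j)

/-- `L(v_{n+1})`: the leaves below the `(n+1)`-st child of `v`. -/
def Lnext (v : T.V) (n : ℕ) : Finset T.V := T.leavesBelow (R.child v n)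

/-- The Haar-like wavelet `φ_{v,n}`. -/
noncomputable def wavelet (v : T.V) (n : ℕ) : T.V → ℝ := fun i =>
  if i ∈ R.Lpart v n then
    Real.sqrt (((R.Lnext v n).card : ℝ) /
      (((R.Lpart v n).card : ℝ) * (((R.Lpart v n ∪ R.Lnext v n)).card : ℝ)))
  else if i ∈ R.Lnext v n then
    - Real.sqrt (((R.Lpart v n).card : ℝ) /
      (((R.Lnext v n).card : ℝ) * (((R.Lpart v n ∪ R.Lnext v n)).card : ℝ)))
  else 0

/-- `ψ` is a Haar-like wavelet associated with the node `v`. -/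
def IsWaveletAt (v : T.V) (ψ : T.V → ℝ) : Prop :=
  (v = T.root ∧ ψ = T.rootWavelet) ∨
    (v ≠ T.root ∧ ∃ n : ℕ, 1 ≤ n ∧ n < k ∧ ψ = R.wavelet v n)

/-- The family of all Haar-like wavelets, as indexed above (the columns of the
Haar-like matrix `Φ`). -/
noncomputable def waveFun : Option (T.V × ℕ) → T.V → ℝ
  | none => T.rootWavelet
  | some (v, n) => R.wavelet v n

/-- The entry of `Φ' C Φ` in row `a` and column `b`. -/
noncomputable def entry (ℓ : T.V → ℝ) (a b : Option (T.V × ℕ)) : ℝ :=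
  ∑ j ∈ T.leaves, ∑ i ∈ T.leaves, R.waveFun a j * T.cov ℓ j i * R.waveFun b i

open Classical in
/-- `ζ`: the fraction of vanishing entries of the `|L| × |L|` matrix `Φ' C Φ`. -/
noncomputable def zeta (ℓ : T.V → ℝ) : ℝ :=
  ((((T.waveletIdx k ×ˢ T.waveletIdx k).filter fun p => R.entry ℓ p.1 p.2 = 0).card : ℝ)) /
    ((T.leaves.card : ℝ)) ^ 2

end KRegStruct

namespace FinRootedTree

variable (T : FinRootedTree)

theorem depth_iter (v : T.V) (m : ℕ) : T.depth (T.parent^[m] v) = T.depth v - m := by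
  induction m with
  | zero => simp
  | succ m ih =>
    rw [Function.iterate_succ_apply']
    by_cases h : T.parent^[m] v = T.root
    · have h0 := (T.depth_eq_zero _).2 h
      rw [h, T.parent_root, (T.depth_eq_zero _).2 rfl]
      omega
    · have := T.depth_parent _ h
      omega

theorem depth_lt_card (v : T.V) : T.depth v < Fintype.card T.V := by
  have h : (Finset.range (T.depth v + 1)).card ≤ (Finset.univ : Finset T.V).card := by
    apply Finset.card_le_card_of_injOn (fun m => T.parent^[m] v)
    · intro x _
      simp
    · intro a ha b hb hab
      have h1 := T.depth_iter v a
      have h2 := T.depth_iter v b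
      simp only [Finset.coe_range, Set.mem_Iio] at ha hb
      have hab' : T.parent^[a] v = T.parent^[b] v := hab
      rw [hab'] at h1
      omega
  rw [Finset.card_range, Finset.card_univ] at h
  omega

theorem mem_ancSelf {v w : T.V} : w ∈ T.ancSelf v ↔ ∃ m, T.parent^[m] v = w := by
  unfold ancSelf
  simp only [Finset.mem_image, Finset.mem_range]
  constructor
  · rintro ⟨m, _, h⟩
    exact ⟨m, h⟩
  · rintro ⟨m, h⟩
    have hc := T.depth_lt_card v
    by_cases hm : m ≤ T.depth v
    · exact ⟨m, by omega, h⟩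
    · refine ⟨T.depth v, by omega, ?_⟩
      have h1 := (T.depth_eq_zero (T.parent^[T.depth v] v)).1 (by rw [depth_iter]; omega)
      have h2 := (T.depth_eq_zero (T.parent^[m] v)).1 (by rw [depth_iter]; omega)
      rw [h1, ← h, h2]

theorem anc_trans {u v w : T.V} (h1 : v ∈ T.ancSelf u) (h2 : w ∈ T.ancSelf v) :
    w ∈ T.ancSelf u := by
  rw [mem_ancSelf] at *
  obtain ⟨a, rfl⟩ := h1
  obtain ⟨b, rfl⟩ := h2
  exact ⟨b + a, by rw [Function.iterate_add_apply]⟩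

theorem anc_total {u v w : T.V} (h1 : v ∈ T.ancSelf u) (h2 : w ∈ T.ancSelf u) :
    v ∈ T.ancSelf w ∨ w ∈ T.ancSelf v := by
  simp only [mem_ancSelf] at *
  obtain ⟨a, rfl⟩ := h1
  obtain ⟨b, rfl⟩ := h2
  rcases le_total a b with h | h
  · exact Or.inr ⟨b - a, by rw [← Function.iterate_add_apply]; congr 2; omega⟩
  · exact Or.inl ⟨a - b, by rw [← Function.iterate_add_apply]; congr 2; omega⟩

theorem anc_eq_of_depth {v w : T.V} (h : v ∈ T.ancSelf w) (hd : T.depth v = T.depth w) :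
    v = w := by
  rw [mem_ancSelf] at h
  obtain ⟨m, rfl⟩ := h
  rw [depth_iter] at hd
  rcases Nat.eq_zero_or_pos m with rfl | hm
  · rfl
  · have h0 : T.depth w = 0 := by omega
    rw [(T.depth_eq_zero _).1 h0]
    apply (T.depth_eq_zero _).1
    rw [depth_iter, (T.depth_eq_zero _).2 rfl]
    omega

theorem mem_children {u v : T.V} : u ∈ T.children v ↔ u ≠ T.root ∧ T.parent u = v := by
  simp [children]

theorem child_unique {i u u' v : T.V} (hu : u ∈ T.children v) (hu' : u' ∈ T.children v)
    (h : u ∈ T.ancSelf i) (h' : u' ∈ T.ancSelf i) : u = u' := by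
  rw [mem_children] at hu hu'
  have d1 := T.depth_parent u hu.1
  have d2 := T.depth_parent u' hu'.1
  rw [hu.2] at d1
  rw [hu'.2] at d2
  rcases T.anc_total h h' with h | h
  · exact T.anc_eq_of_depth h (by omega)
  · exact (T.anc_eq_of_depth h (by omega)).symm

theorem anc_child {u v : T.V} (hu : u ∈ T.children v) : v ∈ T.ancSelf u := by
  rw [mem_children] at hu
  rw [mem_ancSelf]
  exact ⟨1, hu.2⟩

theorem exists_child {v w : T.V} (hv : v ≠ T.root) (h : v ∈ T.ancSelf w) (hne : w ≠ v) :
    ∃ u ∈ T.children v, u ∈ T.ancSelf w := by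
  rw [mem_ancSelf] at h
  obtain ⟨m, hm⟩ := h
  cases m with
  | zero => exact absurd hm hne
  | succ m =>
    rw [Function.iterate_succ_apply'] at hm
    refine ⟨T.parent^[m] w, ?_, T.mem_ancSelf.2 ⟨m, rfl⟩⟩
    rw [mem_children]
    refine ⟨fun h => hv ?_, hm⟩
    rw [← hm, h, T.parent_root]

theorem self_anc (v : T.V) : v ∈ T.ancSelf v := T.mem_ancSelf.2 ⟨0, rfl⟩

theorem mem_leavesBelow {i v : T.V} : i ∈ T.leavesBelow v ↔ i ∈ T.leaves ∧ v ∈ T.ancSelf i := by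
  simp [leavesBelow]

theorem anc_root {w : T.V} (h : w ∈ T.ancSelf T.root) : w = T.root := by
  rw [mem_ancSelf] at h
  obtain ⟨m, rfl⟩ := h
  apply (T.depth_eq_zero _).1
  rw [depth_iter, (T.depth_eq_zero _).2 rfl]
  omega

theorem sum_cov (ℓ ψ : T.V → ℝ) (j : T.V) :
    ∑ i ∈ T.leaves, T.cov ℓ j i * ψ i =
      ∑ w ∈ T.edgesToRoot j, ℓ w * ∑ i ∈ T.leavesBelow w, ψ i := by
  have h1 : ∀ i, T.cov ℓ j i * ψ i =
      ∑ w ∈ T.edgesToRoot j, if w ∈ T.ancSelf i then ℓ w * ψ i else 0 := by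
    intro i
    unfold cov
    rw [Finset.sum_mul, ← Finset.sum_filter]
    apply Finset.sum_congr _ (fun _ _ => rfl)
    ext w
    simp only [edgesToRoot, Finset.mem_inter, Finset.mem_erase, Finset.mem_filter]
    tauto
  simp only [h1]
  rw [Finset.sum_comm]
  apply Finset.sum_congr rfl
  intro w _
  rw [Finset.mul_sum, leavesBelow, Finset.sum_filter]

/-- The abstract argument for a function adapted to the node `v`. -/
theorem cov_mul_aux (ℓ ψ : T.V → ℝ) (v : T.V) (hv : v ≠ T.root)
    (hconst : ∀ u ∈ T.children v, ∀ i ∈ T.leavesBelow u, ∀ i' ∈ T.leavesBelow u, ψ i = ψ i')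
    (hzero : ∀ i, v ∉ T.ancSelf i → ψ i = 0)
    (hsum : ∑ i ∈ T.leavesBelow v, ψ i = 0) (j : T.V) (hj : j ∈ T.leaves) :
    ∑ i ∈ T.leaves, T.cov ℓ j i * ψ i = T.traceLength ℓ j v * ψ j := by
  rw [sum_cov]
  have hanc : ∀ w ∈ T.ancSelf v, ∑ i ∈ T.leavesBelow w, ψ i = 0 := by
    intro w hw
    rw [← hsum]
    symm
    apply Finset.sum_subset
    · intro i hi
      rw [mem_leavesBelow] at *
      exact ⟨hi.1, T.anc_trans hi.2 hw⟩
    · intro i hi hi'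
      rw [mem_leavesBelow] at *
      exact hzero i (fun h => hi' ⟨hi.1, h⟩)
  by_cases hjv : v ∈ T.ancSelf j
  · have hpath : T.pathEdges j v = T.edgesToRoot j \ T.edgesToRoot v := by
      unfold pathEdges
      rw [Finset.union_eq_left]
      intro w hw
      simp only [edgesToRoot, Finset.mem_sdiff, Finset.mem_erase] at hw
      exact absurd ⟨hw.1.1, T.anc_trans hjv hw.1.2⟩ hw.2
    unfold traceLength
    rw [hpath, Finset.sum_mul]
    symm
    apply Finset.sum_subset_zero_on_sdiff Finset.sdiff_subset
    · intro w hw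
      simp only [edgesToRoot, Finset.mem_sdiff, Finset.mem_erase] at hw
      rw [hanc w (by tauto), mul_zero]
    · intro w hw
      simp only [edgesToRoot, Finset.mem_sdiff, Finset.mem_erase] at hw
      obtain ⟨⟨hwr, hwj⟩, hwv⟩ := hw
      have hwv' : w ∉ T.ancSelf v := fun h => hwv ⟨hwr, h⟩
      have hvw : v ∈ T.ancSelf w := (T.anc_total hjv hwj).resolve_right hwv'
      obtain ⟨u, hu, huw⟩ := T.exists_child hv hvw
        (fun h => hwv' (h ▸ T.self_anc w))
      have : ∑ i ∈ T.leavesBelow w, ψ i = ∑ i ∈ T.leavesBelow w, ψ j := by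
        apply Finset.sum_congr rfl
        intro i hi
        rw [mem_leavesBelow] at hi
        exact hconst u hu i (T.mem_leavesBelow.2 ⟨hi.1, T.anc_trans hi.2 huw⟩) j
          (T.mem_leavesBelow.2 ⟨hj, T.anc_trans hwj huw⟩)
      rw [this, Finset.sum_const, nsmul_eq_mul]
      ring
  · rw [hzero j hjv, mul_zero]
    apply Finset.sum_eq_zero
    intro w hw
    simp only [edgesToRoot, Finset.mem_erase] at hw
    by_cases hwv : w ∈ T.ancSelf v
    · rw [hanc w hwv, mul_zero]
    · rw [Finset.sum_eq_zero, mul_zero]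
      intro i hi
      rw [mem_leavesBelow] at hi
      apply hzero
      intro hvi
      rcases T.anc_total hvi hi.2 with h | h
      · exact hjv (T.anc_trans hw.2 h)
      · exact hwv h

end FinRootedTree

theorem haar_sqrt_balance (a b c : ℝ) (ha : 0 ≤ a) (hb : 0 ≤ b) :
    a * Real.sqrt (b / (a * c)) = b * Real.sqrt (a / (b * c)) := by
  rcases ha.eq_or_lt with rfl | ha'
  · simp
  rcases hb.eq_or_lt with rfl | hb'
  · simp
  have h1 : a * Real.sqrt (b / (a * c)) = Real.sqrt (a ^ 2 * (b / (a * c))) := by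
    rw [Real.sqrt_mul (sq_nonneg a), Real.sqrt_sq ha]
  have h2 : b * Real.sqrt (a / (b * c)) = Real.sqrt (b ^ 2 * (a / (b * c))) := by
    rw [Real.sqrt_mul (sq_nonneg b), Real.sqrt_sq hb]
  rw [h1, h2]
  congr 1
  by_cases hc : c = 0
  · simp [hc]
  · field_simp

namespace KRegStruct

variable {k : ℕ} {T : FinRootedTree} (R : KRegStruct k T)

theorem mem_Lpart {v i : T.V} {n : ℕ} :
    i ∈ R.Lpart v n ↔ ∃ s < n, i ∈ T.leavesBelow (R.child v s) := by
  simp [Lpart]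

theorem wavelet_aux (v : T.V) (hv : v ≠ T.root) (hl : ¬ T.IsLeaf v) (n : ℕ) (hn : n < k) :
    (∀ u ∈ T.children v, ∀ i ∈ T.leavesBelow u, ∀ i' ∈ T.leavesBelow u,
      R.wavelet v n i = R.wavelet v n i') ∧
    (∀ i, v ∉ T.ancSelf i → R.wavelet v n i = 0) ∧
    ∑ i ∈ T.leavesBelow v, R.wavelet v n i = 0 := by
  have hkey : ∀ t < k, ∀ s < k, ∀ i ∈ T.leavesBelow (R.child v t),
      i ∈ T.leavesBelow (R.child v s) → s = t := by
    intro t ht s hs i hi hi'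
    rw [T.mem_leavesBelow] at hi hi'
    exact R.child_inj v hv hl s hs t ht
      (T.child_unique (R.child_mem v hv hl s hs) (R.child_mem v hv hl t ht) hi'.2 hi.2)
  have hsub : ∀ s < k, T.leavesBelow (R.child v s) ⊆ T.leavesBelow v := by
    intro s hs i hi
    rw [T.mem_leavesBelow] at *
    exact ⟨hi.1, T.anc_trans hi.2 (T.anc_child (R.child_mem v hv hl s hs))⟩
  have hsubP : R.Lpart v n ⊆ T.leavesBelow v := by
    intro i hi
    obtain ⟨s, hs, h⟩ := R.mem_Lpart.1 hi
    exact hsub s (by omega) h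
  have hsubN : R.Lnext v n ⊆ T.leavesBelow v := hsub n hn
  refine ⟨?_, ?_, ?_⟩
  · intro u hu i hi i' hi'
    obtain ⟨t, ht, rfl⟩ := R.child_surj v hv hl u hu
    have hP : ∀ x ∈ T.leavesBelow (R.child v t), (x ∈ R.Lpart v n ↔ t < n) := by
      intro x hx
      rw [mem_Lpart]
      constructor
      · rintro ⟨s, hs, h⟩
        rw [← hkey t ht s (by omega) x hx h]
        exact hs
      · intro h
        exact ⟨t, h, hx⟩
    have hN : ∀ x ∈ T.leavesBelow (R.child v t), (x ∈ R.Lnext v n ↔ n = t) := by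
      intro x hx
      constructor
      · intro h
        exact hkey t ht n hn x hx h
      · rintro rfl
        exact hx
    unfold wavelet
    simp only [hP i hi, hP i' hi', hN i hi, hN i' hi']
  · intro i hi
    unfold wavelet
    rw [if_neg, if_neg]
    · intro h
      exact hi (T.mem_leavesBelow.1 (hsubN h)).2
    · intro h
      exact hi (T.mem_leavesBelow.1 (hsubP h)).2
  · have hdisj : Disjoint (R.Lpart v n) (R.Lnext v n) := by
      rw [Finset.disjoint_left]
      intro i hi hi'
      obtain ⟨s, hs, h⟩ := R.mem_Lpart.1 hi
      have := hkey n hn s (by omega) i hi' h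
      omega
    have h1 : ∑ i ∈ T.leavesBelow v, R.wavelet v n i =
        ∑ i ∈ R.Lpart v n ∪ R.Lnext v n, R.wavelet v n i := by
      symm
      apply Finset.sum_subset (Finset.union_subset hsubP hsubN)
      intro i _ hi
      rw [Finset.mem_union, not_or] at hi
      unfold wavelet
      rw [if_neg hi.1, if_neg hi.2]
    rw [h1, Finset.sum_union hdisj]
    have h2 : ∀ i ∈ R.Lpart v n, R.wavelet v n i = Real.sqrt (((R.Lnext v n).card : ℝ) /
      (((R.Lpart v n).card : ℝ) * (((R.Lpart v n ∪ R.Lnext v n)).card : ℝ))) := by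
      intro i hi
      unfold wavelet
      rw [if_pos hi]
    have h3 : ∀ i ∈ R.Lnext v n, R.wavelet v n i = - Real.sqrt (((R.Lpart v n).card : ℝ) /
      (((R.Lnext v n).card : ℝ) * (((R.Lpart v n ∪ R.Lnext v n)).card : ℝ))) := by
      intro i hi
      unfold wavelet
      rw [if_neg (fun h => Finset.disjoint_left.1 hdisj h hi), if_pos hi]
    rw [Finset.sum_congr rfl h2, Finset.sum_congr rfl h3, Finset.sum_const, Finset.sum_const,
      nsmul_eq_mul, nsmul_eq_mul, haar_sqrt_balance _ _ _ (Nat.cast_nonneg _) (Nat.cast_nonneg _)]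
    ring

end KRegStruct

/-- If `ψ` is a Haar-like wavelet associated with an interior
node `v` of a `k`-regular tree, then `C ψ = diag(ℓ*(L,v)) ψ`. -/
theorem cov_mul_wavelet (k : ℕ) (hk : 2 ≤ k) (T : FinRootedTree)
    (R : KRegStruct k T) (ℓ : T.V → ℝ) (hℓ : ∀ w : T.V, w ≠ T.root → 0 < ℓ w)
    (v : T.V) (hv : v ∈ T.interior) (ψ : T.V → ℝ) (hψ : R.IsWaveletAt v ψ) :
    ∀ j ∈ T.leaves, ∑ i ∈ T.leaves, T.cov ℓ j i * ψ i = T.traceLength ℓ j v * ψ j := by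
  intro j hj
  rcases hψ with ⟨rfl, rfl⟩ | ⟨hvr, n, _, hn, rfl⟩
  · rw [T.sum_cov]
    have he : T.edgesToRoot T.root = ∅ := by
      ext w
      simp only [FinRootedTree.edgesToRoot, Finset.mem_erase, Finset.notMem_empty, iff_false]
      rintro ⟨h1, h2⟩
      exact h1 (T.anc_root h2)
    have hp : T.pathEdges j T.root = T.edgesToRoot j := by
      simp [FinRootedTree.pathEdges, he]
    unfold FinRootedTree.traceLength FinRootedTree.rootWavelet
    rw [hp, Finset.sum_mul]
    apply Finset.sum_congr rfl
    intro w _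
    rw [Finset.sum_const, nsmul_eq_mul]
    ring
  · have hl : ¬ T.IsLeaf v := by
      simpa [FinRootedTree.interior] using hv
    obtain ⟨h1, h2, h3⟩ := R.wavelet_aux v hvr hl n hn
    exact T.cov_mul_aux ℓ _ v hvr h1 h2 h3 j hj
end

section
/- Let k ≥ 2 and let a_n = (1/((k−1)n+1))·binom(kn, n) be the Fuss–Catalan numbers. Then the series ∑_{n≥0} a_n z^n converges absolutely for every complex z with |z| ≤ z_k := (k−1)^{k−1}/k^k, and for every real t with 0 ≤ t ≤ 1/k one has ∑_{n≥0} a_n (t(1−t)^{k−1})^n = 1/(1−t). -/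
/-- The Fuss–Catalan numbers with parameter `k`, as real numbers:
`a_n = (1/((k-1)n+1)) · C(kn, n)`. -/
noncomputable def fussCatalanR (k n : ℕ) : ℝ :=
  (Nat.choose (k * n) n : ℝ) / (((k : ℝ) - 1) * (n : ℝ) + 1)

/-- `z_k = (k-1)^{k-1}/k^k`. -/
noncomputable def zk (k : ℕ) : ℝ := ((k : ℝ) - 1) ^ (k - 1) / (k : ℝ) ^ k

open Finset in
lemma fc_prod_erase (n j : ℕ) :
    ∏ i ∈ (range (n + j + 1)).erase n, ((n : ℝ) - (i : ℝ)) =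
      (-1) ^ j * (n.factorial : ℝ) * (j.factorial : ℝ) := by
  induction j with
  | zero =>
    have : (range (n + 0 + 1)).erase n = range n := by
      ext x; simp; omega
    rw [this]
    have h2 : (∏ i ∈ range n, ((n : ℝ) - (i : ℝ))) = (n.descFactorial n : ℝ) := by
      rw [← descPochhammer_eval_eq_descFactorial ℝ, descPochhammer_eval_eq_prod_range]
    rw [h2, Nat.descFactorial_self]; simp
  | succ j ih =>
    have : (range (n + (j + 1) + 1)).erase n = insert (n + j + 1) ((range (n + j + 1)).erase n) := by
      ext x; simp; omega
    rw [this, prod_insert (by simp), ih, Nat.factorial_succ]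
    push_cast; ring

open Finset in
lemma fc_comb (q : ℕ) (hq : 1 ≤ q) (m : ℕ) :
    ∑ x ∈ antidiagonal m, fussCatalanR (q + 1) x.1 *
      (((q * x.1).choose x.2 : ℝ) * (-1) ^ x.2) = 1 := by
  have hq0 : (0 : ℝ) < q := by exact_mod_cast hq
  set c : ℝ := 1 / q with hc
  have hc0 : 0 < c := by positivity
  set P : Polynomial ℝ := (descPochhammer ℝ m).comp (Polynomial.C ((q : ℝ) + 1) * Polynomial.X)
    with hP
  have hdeg : P.degree < ((range (m + 1)).card : ℕ) := by
    refine lt_of_le_of_lt Polynomial.degree_le_natDegree ?_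
    rw [hP, Polynomial.natDegree_comp, descPochhammer_natDegree,
      Polynomial.natDegree_C_mul_X _ (by positivity)]
    simp only [mul_one, card_range]
    exact_mod_cast Nat.lt_succ_self m
  have hint := Lagrange.eq_interpolate (s := range (m + 1)) (v := fun i : ℕ => (i : ℝ)) (f := P)
    (fun a _ b _ h => by simpa using h) hdeg
  have h1 := Lagrange.eval_interpolate_not_at_node (s := range (m + 1)) (v := fun i : ℕ => (i : ℝ))
    (fun i => Polynomial.eval (i : ℝ) P) (x := -c)
    (fun i _ => by have : (0 : ℝ) ≤ i := i.cast_nonneg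
                   intro h; linarith)
  rw [← hint, Lagrange.eval_nodal, prod_range_succ'] at h1
  have h2 : P.eval (-c) = ∏ i ∈ range m, (-c - ((i + 1 : ℕ) : ℝ)) := by
    rw [hP, Polynomial.eval_comp, descPochhammer_eval_eq_prod_range]
    refine prod_congr rfl fun i _ => ?_
    simp only [Polynomial.eval_mul, Polynomial.eval_C, Polynomial.eval_X, hc]
    push_cast
    field_simp
    ring
  rw [h2] at h1
  have hA : ∏ i ∈ range m, (-c - ((i + 1 : ℕ) : ℝ)) ≠ 0 := by
    refine prod_ne_zero_iff.2 fun i _ => ?_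
    have : (0 : ℝ) ≤ ((i + 1 : ℕ) : ℝ) := Nat.cast_nonneg _
    intro h; linarith
  rw [mul_assoc] at h1
  have h3 := mul_left_cancel₀ hA ((mul_one _).trans h1)
  refine Eq.trans ?_ h3.symm
  rw [Finset.Nat.sum_antidiagonal_eq_sum_range_succ_mk, mul_sum]
  refine sum_congr rfl fun n hn => ?_
  obtain ⟨j, rfl⟩ : ∃ j, m = n + j := Nat.exists_eq_add_of_le (by simp at hn; omega)
  have hev : P.eval (n : ℝ) = ((n + j).factorial : ℝ) * (((q + 1) * n).choose (n + j) : ℝ) := by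
    rw [hP, Polynomial.eval_comp]
    simp only [Polynomial.eval_mul, Polynomial.eval_C, Polynomial.eval_X]
    have := descPochhammer_eval_eq_descFactorial ℝ ((q + 1) * n) (n + j)
    push_cast at this
    rw [this, Nat.descFactorial_eq_factorial_mul_choose]
    push_cast; rfl
  have hch : ((((q + 1) * n).choose (n + j) : ℕ) : ℝ) * ((n + j).choose n : ℝ) =
      (((q + 1) * n).choose n : ℝ) * ((q * n).choose j : ℝ) := by
    have := Nat.choose_mul (n := (q + 1) * n) (k := n + j) (s := n) (by omega)
    rw [show (q + 1) * n - n = q * n by rw [Nat.succ_mul]; omega, Nat.add_sub_cancel_left] at this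
    exact_mod_cast this
  have hf : ((n + j).choose n : ℝ) * (n.factorial : ℝ) * (j.factorial : ℝ) =
      ((n + j).factorial : ℝ) := by
    have := Nat.choose_mul_factorial_mul_factorial (n := n + j) (k := n) (by omega)
    rw [Nat.add_sub_cancel_left] at this
    exact_mod_cast this
  have hn0 : (n.factorial : ℝ) ≠ 0 := by positivity
  have hj0 : (j.factorial : ℝ) ≠ 0 := by positivity
  have hw : Lagrange.nodalWeight (range (n + j + 1)) (fun i : ℕ => (i : ℝ)) n =
      ((-1) ^ j * (n.factorial : ℝ) * (j.factorial : ℝ))⁻¹ := by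
    rw [Lagrange.nodalWeight, prod_inv_distrib, fc_prod_erase]
  have hs : ((-1 : ℝ) ^ j)⁻¹ = (-1) ^ j := by
    rw [← inv_pow]; norm_num
  have hcn : (-c - ((0 : ℕ) : ℝ)) * (-c - (n : ℝ))⁻¹ = ((q : ℝ) * n + 1)⁻¹ := by
    have : (-c - (n : ℝ)) = -(((q : ℝ) * n + 1) * c) := by rw [hc]; field_simp; ring
    have h9 : ((q : ℝ) * n + 1) ≠ 0 := by positivity
    rw [this]; field_simp; simp
  simp only [Nat.add_sub_cancel_left]
  rw [hev, hw, fussCatalanR]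
  have e1 : (((q + 1 : ℕ) : ℝ) - 1) = q := by push_cast; ring
  rw [e1, mul_inv, mul_inv, hs]
  calc _ = (((q + 1) * n).choose n : ℝ) * ((q * n).choose j : ℝ) * (-1) ^ j * ((q : ℝ) * n + 1)⁻¹ := by
        field_simp
    _ = _ := by
        rw [← hch, ← hcn, ← hf]
        field_simp

lemma fc_nonneg (q n : ℕ) : 0 ≤ fussCatalanR (q + 1) n := by
  unfold fussCatalanR; push_cast; rw [add_sub_cancel_right]; positivity

lemma fc_zk (q : ℕ) : zk (q + 1) = (1 / ((q : ℝ) + 1)) * (1 - 1 / ((q : ℝ) + 1)) ^ q := by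
  have h : (1 - 1 / ((q : ℝ) + 1)) = q / ((q : ℝ) + 1) := by field_simp; ring
  unfold zk
  rw [h, div_pow, pow_succ]
  simp only [Nat.add_sub_cancel]
  push_cast
  rw [add_sub_cancel_right]
  field_simp

lemma fc_bound (q n : ℕ) : fussCatalanR (q + 1) n * zk (q + 1) ^ n ≤ 1 := by
  set x : ℝ := 1 / ((q : ℝ) + 1) with hx
  have hx0 : 0 ≤ x := by positivity
  have hx1 : 0 ≤ 1 - x := by
    rw [sub_nonneg, hx, div_le_one (by positivity)]
    have : (0 : ℝ) ≤ q := q.cast_nonneg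
    linarith
  have h1 : fussCatalanR (q + 1) n ≤ (((q + 1) * n).choose n : ℝ) := by
    unfold fussCatalanR; push_cast; rw [add_sub_cancel_right]
    apply div_le_self (by positivity)
    have : (0 : ℝ) ≤ q * n := by positivity
    linarith
  have h2 : (((q + 1) * n).choose n : ℝ) * (x * (1 - x) ^ q) ^ n ≤ 1 := by
    have := add_pow x (1 - x) ((q + 1) * n)
    rw [add_sub_cancel, one_pow] at this
    refine le_of_le_of_eq ?_ this.symm
    have h3 := Finset.single_le_sum (s := Finset.range ((q + 1) * n + 1))
      (f := fun m => x ^ m * (1 - x) ^ ((q + 1) * n - m) * (((q + 1) * n).choose m : ℝ))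
      (fun i _ => by positivity) (a := n) (by simp; nlinarith)
    refine le_trans (le_of_eq ?_) h3
    rw [show (q + 1) * n - n = q * n by rw [Nat.succ_mul]; omega, mul_pow, pow_mul]
    ring
  rw [fc_zk]
  exact le_trans (mul_le_mul_of_nonneg_right h1 (by positivity)) h2

lemma fc_zk_pos (q : ℕ) (hq : 1 ≤ q) : 0 < zk (q + 1) := by
  unfold zk
  have hq0 : (0 : ℝ) < q := by exact_mod_cast hq
  push_cast
  rw [add_sub_cancel_right]
  positivity

lemma fc_summable (q : ℕ) (hq : 1 ≤ q) (r : ℝ) (hr : 0 ≤ r) (hr1 : r < zk (q + 1)) :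
    Summable fun n => fussCatalanR (q + 1) n * r ^ n := by
  have hz := fc_zk_pos q hq
  refine Summable.of_nonneg_of_le (fun n => mul_nonneg (fc_nonneg q n) (by positivity))
    (fun n => ?_) (summable_geometric_of_lt_one (r := r / zk (q + 1)) (by positivity)
      (by rwa [div_lt_one hz]))
  have h := fc_bound q n
  rw [div_pow, le_div_iff₀ (by positivity)]
  calc _ = r ^ n * (fussCatalanR (q + 1) n * zk (q + 1) ^ n) := by ring
    _ ≤ r ^ n * 1 := by gcongr
    _ = _ := mul_one _

lemma fc_binom_hasSum (a x : ℝ) (N : ℕ) :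
    HasSum (fun j => a * ((N.choose j : ℝ) * x ^ j)) (a * (1 + x) ^ N) := by
  apply HasSum.mul_left
  have h := hasSum_sum_of_ne_finset_zero (L := SummationFilter.unconditional ℕ) (s := Finset.range (N + 1))
    (f := fun j => (N.choose j : ℝ) * x ^ j) (fun j hj => by
      rw [Nat.choose_eq_zero_of_lt (by simp at hj; omega)]; simp)
  have e : (1 + x) ^ N = ∑ j ∈ Finset.range (N + 1), (N.choose j : ℝ) * x ^ j := by
    rw [add_comm, add_pow]
    refine Finset.sum_congr rfl fun i _ => ?_
    simp [mul_comm]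
  rw [e]
  exact h

open Finset in
lemma fc_local (q : ℕ) (hq : 1 ≤ q) (t : ℝ) (ht1 : |t| < 1)
    (ht : |t| * (1 + |t|) ^ q < zk (q + 1)) :
    ∑' n : ℕ, fussCatalanR (q + 1) n * (t * (1 - t) ^ q) ^ n = 1 / (1 - t) := by
  set f : ℕ × ℕ → ℝ := fun x => fussCatalanR (q + 1) x.1 * t ^ x.1 *
    (((q * x.1).choose x.2 : ℝ) * (-t) ^ x.2) with hf
  have hfs : Summable f := by
    rw [← summable_abs_iff]
    have hab : ∀ n j, |f (n, j)| = fussCatalanR (q + 1) n * |t| ^ n *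
        (((q * n).choose j : ℝ) * |t| ^ j) := by
      intro n j
      simp only [hf, abs_mul, abs_pow, abs_neg, abs_of_nonneg (fc_nonneg q n), Nat.abs_cast]
    rw [summable_prod_of_nonneg (fun x => abs_nonneg _)]
    simp only [hab]
    refine ⟨fun n => (fc_binom_hasSum _ _ _).summable, ?_⟩
    simp only [(fc_binom_hasSum _ _ _).tsum_eq]
    convert fc_summable q hq _ (by positivity) ht using 2 with n
    rw [mul_pow, pow_mul]; ring
  have h1 : ∑' x, f x = ∑' n : ℕ, fussCatalanR (q + 1) n * (t * (1 - t) ^ q) ^ n := by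
    rw [hfs.tsum_prod]
    refine tsum_congr fun n => ?_
    simp only [hf]
    rw [(fc_binom_hasSum _ _ _).tsum_eq, mul_pow, ← pow_mul]; ring
  have h2 : ∑' x, f x = ∑' m : ℕ, t ^ m := by
    rw [← HasAntidiagonal.sigmaAntidiagonalEquivProd.tsum_eq]
    refine (Summable.tsum_sigma' (fun n => (hasSum_fintype _).summable)
        (HasAntidiagonal.sigmaAntidiagonalEquivProd.summable_iff.2 hfs)).trans ?_
    refine tsum_congr fun m => ?_
    rw [tsum_fintype]
    have := Finset.sum_coe_sort (antidiagonal m) f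
    refine Eq.trans this ?_
    rw [← one_mul (t ^ m), ← fc_comb q hq m, sum_mul]
    refine sum_congr rfl fun x hx => ?_
    rw [← mem_antidiagonal.1 hx]
    simp only [hf]
    rw [neg_pow t, pow_add]; ring
  rw [← h1, h2, tsum_geometric_of_abs_lt_one ht1, one_div]

lemma fc_strictMono (q : ℕ) (hq : 1 ≤ q) :
    StrictMonoOn (fun t : ℝ => t * (1 - t) ^ q) (Set.Icc 0 (1 / ((q : ℝ) + 1))) := by
  have hq0 : (0 : ℝ) < q := by exact_mod_cast hq
  apply strictMonoOn_of_deriv_pos (convex_Icc _ _) (by fun_prop)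
  intro x hx
  rw [interior_Icc] at hx
  obtain ⟨h0, h1⟩ := hx
  rw [lt_div_iff₀ (by positivity)] at h1
  have hd : HasDerivAt (fun t : ℝ => t * (1 - t) ^ q)
      (1 * (1 - x) ^ q + x * (q * (1 - x) ^ (q - 1) * (-1))) x := by
    have := ((hasDerivAt_id x).const_sub 1).pow q
    exact (hasDerivAt_id x).mul this
  rw [hd.deriv]
  obtain ⟨r, rfl⟩ : ∃ r, q = r + 1 := ⟨q - 1, by omega⟩
  simp only [Nat.add_sub_cancel]
  have h3 : 0 < 1 - x := by nlinarith
  have h4 : 0 < 1 - x * (((r + 1 : ℕ) : ℝ) + 1) := by linarith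
  have := mul_pos (pow_pos h3 r) h4
  rw [pow_succ]
  linarith

lemma fc_interior (q : ℕ) (hq : 1 ≤ q) :
    ∀ t ∈ Set.Ico (0 : ℝ) (1 / ((q : ℝ) + 1)),
      0 ≤ t * (1 - t) ^ q ∧ t * (1 - t) ^ q < zk (q + 1) ∧
      ∑' n : ℕ, fussCatalanR (q + 1) n * (t * (1 - t) ^ q) ^ n = 1 / (1 - t) := by
  have hq0 : (0 : ℝ) < q := by exact_mod_cast hq
  have hz := fc_zk_pos q hq
  have hK1 : 1 / ((q : ℝ) + 1) < 1 := by rw [div_lt_one (by positivity)]; linarith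
  have hK0 : 0 < 1 / ((q : ℝ) + 1) := by positivity
  have hp0 : ∀ t ∈ Set.Ico (0 : ℝ) (1 / ((q : ℝ) + 1)), 0 ≤ t * (1 - t) ^ q := fun t ht =>
    mul_nonneg ht.1 (pow_nonneg (by linarith [ht.2]) _)
  have hp1 : ∀ t ∈ Set.Ico (0 : ℝ) (1 / ((q : ℝ) + 1)), t * (1 - t) ^ q < zk (q + 1) := by
    intro t ht
    rw [fc_zk]
    exact fc_strictMono q hq ⟨ht.1, ht.2.le⟩ ⟨hK0.le, le_rfl⟩ ht.2
  suffices hE : Set.EqOn (fun t : ℝ => ∑' n : ℕ, fussCatalanR (q + 1) n * (t * (1 - t) ^ q) ^ n)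
      (fun t => 1 / (1 - t)) (Set.Ico (0 : ℝ) (1 / ((q : ℝ) + 1))) from
    fun t ht => ⟨hp0 t ht, hp1 t ht, hE ht⟩
  set F := FormalMultilinearSeries.ofScalars ℝ (fussCatalanR (q + 1)) with hF
  have hrad : ENNReal.ofReal (zk (q + 1)) ≤ F.radius := by
    apply F.le_radius_of_bound 1
    intro n
    rw [hF, FormalMultilinearSeries.ofScalars_norm, Real.norm_of_nonneg (fc_nonneg q n),
      Real.coe_toNNReal _ hz.le]
    exact fc_bound q n
  have hFa : AnalyticOnNhd ℝ F.sum (Metric.ball 0 (zk (q + 1))) := by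
    have h := (F.hasFPowerSeriesOnBall
      (lt_of_lt_of_le (ENNReal.ofReal_pos.2 hz) hrad)).analyticOnNhd
    rw [← Metric.eball_ofReal]
    exact h.mono (Metric.eball_subset_eball hrad)
  have hsum : ∀ x, F.sum x = ∑' n : ℕ, fussCatalanR (q + 1) n * x ^ n := by
    intro x
    have := FormalMultilinearSeries.ofScalars_sum_eq (E := ℝ) (fussCatalanR (q + 1)) x
    simpa [FormalMultilinearSeries.ofScalarsSum] using this
  refine AnalyticOnNhd.eqOn_of_preconnected_of_eventuallyEq (𝕜 := ℝ) (z₀ := 0) ?_ ?_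
    isPreconnected_Ico ⟨le_rfl, hK0⟩ ?_
  · have hc := hFa.comp (s := Set.Ico (0 : ℝ) (1 / ((q : ℝ) + 1)))
      (f := fun t : ℝ => t * (1 - t) ^ q) (fun t _ => by fun_prop) (fun t ht => by
        simp only [Metric.mem_ball, dist_zero_right]
        rw [Real.norm_of_nonneg (hp0 t ht)]
        exact hp1 t ht)
    convert hc using 1
    funext t
    simp only [Function.comp, hsum]
  · intro t ht
    exact analyticAt_const.div (by fun_prop) (by linarith [ht.2])
  · have c1 : Filter.Tendsto (fun t : ℝ => |t|) (nhds 0) (nhds 0) := by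
      simpa using (continuous_abs.tendsto (0 : ℝ))
    have c2 : Filter.Tendsto (fun t : ℝ => |t| * (1 + |t|) ^ q) (nhds 0) (nhds 0) := by
      have : Continuous (fun t : ℝ => |t| * (1 + |t|) ^ q) := by fun_prop
      simpa using this.tendsto 0
    filter_upwards [c1.eventually_lt_const one_pos, c2.eventually_lt_const hz] with t h1 h2
    exact fc_local q hq t h1 h2

lemma fc_boundary (q : ℕ) (hq : 1 ≤ q) :
    HasSum (fun n => fussCatalanR (q + 1) n * zk (q + 1) ^ n) (1 / (1 - 1 / ((q : ℝ) + 1))) := by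
  have hq0 : (0 : ℝ) < q := by exact_mod_cast hq
  have hz := fc_zk_pos q hq
  set K : ℝ := 1 / ((q : ℝ) + 1) with hK
  have hK1 : K < 1 := by rw [hK, div_lt_one (by positivity)]; linarith
  have hK0 : 0 < K := by positivity
  have hin := fc_interior q hq
  rw [← hK] at hin
  have hev : ∀ᶠ t in nhdsWithin K (Set.Iio K), t ∈ Set.Ico 0 K := by
    filter_upwards [Ioo_mem_nhdsLT hK0] with t ht using ⟨ht.1.le, ht.2⟩
  have hpart : ∀ N, ∑ n ∈ Finset.range N, fussCatalanR (q + 1) n * zk (q + 1) ^ n ≤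
      1 / (1 - K) := by
    intro N
    have hcont : Continuous fun t : ℝ =>
      ∑ n ∈ Finset.range N, fussCatalanR (q + 1) n * (t * (1 - t) ^ q) ^ n := by fun_prop
    have hl := (hcont.tendsto K).mono_left (nhdsWithin_le_nhds (s := Set.Iio K))
    rw [fc_zk, ← hK]
    refine le_of_tendsto hl ?_
    filter_upwards [hev] with t ht
    obtain ⟨h0, h1, h2⟩ := hin t ht
    calc _ ≤ ∑' n : ℕ, fussCatalanR (q + 1) n * (t * (1 - t) ^ q) ^ n :=
          (fc_summable q hq _ h0 h1).sum_le_tsum _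
            (fun n _ => mul_nonneg (fc_nonneg q n) (pow_nonneg h0 n))
      _ = 1 / (1 - t) := h2
      _ ≤ 1 / (1 - K) := one_div_le_one_div_of_le (by linarith) (by linarith [ht.2])
  have hnn : ∀ n, 0 ≤ fussCatalanR (q + 1) n * zk (q + 1) ^ n := fun n =>
    mul_nonneg (fc_nonneg q n) (by positivity)
  have hs : Summable (fun n => fussCatalanR (q + 1) n * zk (q + 1) ^ n) :=
    summable_of_sum_range_le hnn hpart
  have hle : ∑' n, fussCatalanR (q + 1) n * zk (q + 1) ^ n ≤ 1 / (1 - K) :=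
    hs.tsum_le_of_sum_range_le hpart
  have hge : 1 / (1 - K) ≤ ∑' n, fussCatalanR (q + 1) n * zk (q + 1) ^ n := by
    have hc : ContinuousAt (fun t : ℝ => 1 / (1 - t)) K :=
      continuousAt_const.div (by fun_prop) (by linarith)
    have hl := hc.tendsto.mono_left (nhdsWithin_le_nhds (s := Set.Iio K))
    refine le_of_tendsto hl ?_
    filter_upwards [hev] with t ht
    obtain ⟨h0, h1, h2⟩ := hin t ht
    rw [← h2]
    refine (fc_summable q hq _ h0 h1).tsum_le_tsum (fun n => ?_) hs
    exact mul_le_mul_of_nonneg_left (pow_le_pow_left₀ h0 h1.le n) (fc_nonneg q n)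
  rw [← le_antisymm hle hge]
  exact hs.hasSum

/-- The Fuss–Catalan generating series converges absolutely
on the closed disk `|z| ≤ z_k`, and for `0 ≤ t ≤ 1/k` one has
`∑_{n≥0} a_n (t(1-t)^{k-1})^n = 1/(1-t)`. -/
theorem fussCatalan_abs_convergence_and_value (k : ℕ) (hk : 2 ≤ k) :
    (∀ z : ℂ, ‖z‖ ≤ zk k →
        Summable fun n : ℕ => ‖(fussCatalanR k n : ℂ) * z ^ n‖) ∧
      ∀ t : ℝ, 0 ≤ t → t ≤ 1 / (k : ℝ) →
        ∑' n : ℕ, fussCatalanR k n * (t * (1 - t) ^ (k - 1)) ^ n = 1 / (1 - t) := by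
  obtain ⟨q, rfl⟩ : ∃ q, k = q + 1 := ⟨k - 1, by omega⟩
  have hq : 1 ≤ q := by omega
  constructor
  · intro z hz
    refine Summable.of_nonneg_of_le (fun n => norm_nonneg _) (fun n => ?_)
      (fc_boundary q hq).summable
    rw [norm_mul, norm_pow, Complex.norm_real, Real.norm_of_nonneg (fc_nonneg q n)]
    exact mul_le_mul_of_nonneg_left (pow_le_pow_left₀ (norm_nonneg _) hz n) (fc_nonneg q n)
  · intro t h0 h1
    simp only [Nat.add_sub_cancel]
    push_cast at h1
    rcases h1.lt_or_eq with h | h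
    · exact (fc_interior q hq t ⟨h0, h⟩).2.2
    · have := (fc_boundary q hq).tsum_eq
      rw [fc_zk, ← h] at this
      exact this
end

section
/- There exists K ≥ 2 such that for every integer k ≥ K the following holds: for every complex number z with |z| = z_k and z ≠ z_k, there exists t ∈ ℂ with |t| < 1/k such that t(1−t)^{k−1} = z, where z_k := (k−1)^{k−1}/k^k. -/
theorem zk_aux (k : ℕ) (hk : 2 ≤ k) : zk k = 1 / (k : ℝ) * (1 - 1 / (k : ℝ)) ^ (k - 1) := by
  have h0 : (k : ℝ) ≠ 0 := by positivity
  have h1 : (1 - 1 / (k : ℝ)) = ((k : ℝ) - 1) / k := by field_simp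
  obtain ⟨n, rfl⟩ : ∃ n, k = n + 1 := ⟨k - 1, by omega⟩
  rw [h1, zk, div_pow, Nat.add_sub_cancel, pow_succ (((n + 1 : ℕ) : ℝ)) n]
  field_simp

theorem norm_ge_aux (k : ℕ) (hk : 2 ≤ k) (t : ℂ) (ht : ‖t‖ = 1 / (k : ℝ)) :
    zk k ≤ ‖t * (1 - t) ^ (k - 1)‖ := by
  have hk2 : (2 : ℝ) ≤ k := by exact_mod_cast hk
  have h1 : 1 / (k : ℝ) ≤ 1 := by rw [div_le_one (by linarith)]; linarith
  have h2 : 1 - 1 / (k : ℝ) ≤ ‖1 - t‖ := by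
    have := norm_sub_norm_le (1 : ℂ) t
    rwa [norm_one, ht] at this
  have h3 : 0 ≤ 1 - 1 / (k : ℝ) := by linarith
  rw [zk_aux k hk, norm_mul, norm_pow, ht]
  gcongr

theorem norm_eq_aux (k : ℕ) (hk : 2 ≤ k) (t : ℂ) (ht : ‖t‖ = 1 / (k : ℝ))
    (h : ‖t * (1 - t) ^ (k - 1)‖ = zk k) : t = ((1 / (k : ℝ) : ℝ) : ℂ) := by
  have hk2 : (2 : ℝ) ≤ k := by exact_mod_cast hk
  have hp : 0 < 1 / (k : ℝ) := by positivity
  have h1 : 1 / (k : ℝ) ≤ 1 := by rw [div_le_one (by linarith)]; linarith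
  rw [zk_aux k hk, norm_mul, norm_pow, ht] at h
  have h2 := mul_left_cancel₀ hp.ne' h
  have h3 := (pow_left_inj₀ (norm_nonneg _) (by linarith) (by omega)).1 h2
  have e1 : t.re * t.re + t.im * t.im = (1 / (k : ℝ)) ^ 2 := by
    rw [← ht, ← Complex.normSq_eq_norm_sq, Complex.normSq_apply]
  have e2 : (1 - t.re) * (1 - t.re) + t.im * t.im = (1 - 1 / (k : ℝ)) ^ 2 := by
    rw [← h3, ← Complex.normSq_eq_norm_sq, Complex.normSq_apply]; simp
  generalize 1 / (k : ℝ) = r at *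
  have e3 : t.re = r := by linarith
  rw [e3] at e1
  have e4 : t.im = 0 := by
    have : t.im * t.im = 0 := by linarith
    simpa using this
  apply Complex.ext <;> simp [e3, e4]

/-- `z_k` is positive and every `z` of norm at most `z_k` is attained in the closed disk. -/
theorem closed_aux (k : ℕ) (hk : 2 ≤ k) (z : ℂ) (hz : ‖z‖ = zk k) :
    ∃ t : ℂ, ‖t‖ ≤ 1 / (k : ℝ) ∧ t * (1 - t) ^ (k - 1) = z := by
  have hk2 : (2 : ℝ) ≤ k := by exact_mod_cast hk
  have hp : 0 < 1 / (k : ℝ) := by positivity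
  have h1 : 1 / (k : ℝ) < 1 := by rw [div_lt_one (by linarith)]; linarith
  have hzk : 0 < zk k := by
    rw [zk_aux k hk]
    have : 0 < 1 - 1 / (k : ℝ) := by linarith
    positivity
  let p : ℂ → ℂ := fun t => t * (1 - t) ^ (k - 1)
  have hpd : Differentiable ℂ p := by fun_prop
  have hcomp : IsCompact (p '' Metric.closedBall 0 (1 / (k : ℝ))) :=
    (isCompact_closedBall _ _).image hpd.continuous
  have hopen : IsOpen (p '' Metric.ball 0 (1 / (k : ℝ))) := by
    have han : AnalyticOnNhd ℂ p Set.univ := fun x _ => hpd.analyticAt x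
    rcases han.is_constant_or_isOpen isPreconnected_univ with ⟨w, hw⟩ | h
    · exfalso
      have a := hw 0 trivial
      have b := hw ((1 / (k : ℝ) : ℝ) : ℂ) trivial
      rw [← a] at b
      have := norm_ge_aux k hk ((1 / (k : ℝ) : ℝ) : ℂ)
        (by rw [Complex.norm_real, Real.norm_of_nonneg hp.le])
      change zk k ≤ ‖p _‖ at this
      rw [b] at this
      simp [p] at this
      linarith
    · exact h _ (Set.subset_univ _) Metric.isOpen_ball
  have hsub : Metric.ball (0 : ℂ) (zk k) ⊆ p '' Metric.ball 0 (1 / (k : ℝ)) := by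
    apply IsPreconnected.subset_of_closure_inter_subset
      (convex_ball (0 : ℂ) (zk k)).isPreconnected hopen
    · exact ⟨0, by simpa using hzk, 0, Metric.mem_ball_self hp, by simp [p]⟩
    · rintro w ⟨hw, hwb⟩
      have : w ∈ p '' Metric.closedBall 0 (1 / (k : ℝ)) :=
        closure_minimal (Set.image_mono Metric.ball_subset_closedBall) hcomp.isClosed hw
      obtain ⟨t, ht, rfl⟩ := this
      refine ⟨t, ?_, rfl⟩
      rw [mem_closedBall_zero_iff] at ht
      rw [mem_ball_zero_iff] at hwb ⊢
      refine lt_of_le_of_ne ht fun he => ?_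
      exact absurd (norm_ge_aux k hk t he) (not_le.2 hwb)
  have hmem : z ∈ closure (Metric.ball (0 : ℂ) (zk k)) := by
    rw [closure_ball _ hzk.ne', mem_closedBall_zero_iff, hz]
  obtain ⟨t, ht, hpt⟩ := closure_minimal
    (hsub.trans (Set.image_mono Metric.ball_subset_closedBall)) hcomp.isClosed hmem
  exact ⟨t, by simpa [mem_closedBall_zero_iff] using ht, hpt⟩

/-- For all sufficiently large `k`: every point `z ≠ z_k` of
the circle `|z| = z_k` is attained by `p(t) = t(1-t)^{k-1}` at some `t` with
`|t| < 1/k`. -/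
theorem circle_attained_in_disk :
    ∃ K : ℕ, 2 ≤ K ∧ ∀ k : ℕ, K ≤ k →
      ∀ z : ℂ, ‖z‖ = zk k → z ≠ (zk k : ℂ) →
        ∃ t : ℂ, ‖t‖ < 1 / (k : ℝ) ∧ t * (1 - t) ^ (k - 1) = z := by
  refine ⟨2, le_rfl, fun k hk z hz hne => ?_⟩
  obtain ⟨t, ht, hpt⟩ := closed_aux k hk z hz
  refine ⟨t, lt_of_le_of_ne ht fun he => hne ?_, hpt⟩
  have := norm_eq_aux k hk t he (by rw [hpt, hz])
  rw [← hpt, this, zk_aux k hk]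
  push_cast
  rfl
end

section
/- Let k ≥ 3, let a_n = (1/((k−1)n+1))·binom(kn, n) be the Fuss–Catalan numbers, let z_k := (k−1)^{k−1}/k^k, and define Q(z) := ∑_{n≥0} a_n z^n for complex |z| ≤ z_k (the series converges absolutely there). Then the only complex z with |z| ≤ z_k satisfying k·z·Q(z)^{k−1} = 1 is z = z_k. -/
/-- `Q(z) = ∑ a_n z^n` on the closed disk `|z| ≤ z_k`. -/
noncomputable def Qc (k : ℕ) (z : ℂ) : ℂ := ∑' n : ℕ, (fussCatalanR k n : ℂ) * z ^ n

/-- Coefficients of the `r`-th power of the Fuss–Catalan series. -/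
noncomputable def fcA (k r : ℕ) : ℕ → ℝ
  | 0 => 1
  | n + 1 => ((k * (n + 1) + r).choose (n + 1) : ℝ) - k * ((k * (n + 1) + r - 1).choose n : ℝ)

lemma fcA_rec (k r n : ℕ) (hk : 1 ≤ k) :
    fcA k (r + 1) (n + 1) = fcA k r (n + 1) + fcA k (r + k) n := by
  obtain ⟨k, rfl⟩ : ∃ j, k = j + 1 := ⟨k - 1, by omega⟩
  rcases n with _ | n
  · simp [fcA]
  · simp only [fcA]
    obtain ⟨M, hM⟩ : ∃ M, (k + 1) * (n + 1 + 1) + r = M + 1 :=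
      ⟨(k + 1) * (n + 1) + k + r, by ring⟩
    have h2 : (k + 1) * (n + 1) + (r + (k + 1)) = M + 1 := by rw [← hM]; ring
    rw [← add_assoc, hM, h2]
    simp only [Nat.add_sub_cancel]
    rw [Nat.choose_succ_succ (M + 1) (n + 1), Nat.choose_succ_succ M n]
    push_cast
    ring

lemma fcA_zero (k n : ℕ) (hk : 1 ≤ k) : fcA k 0 (n + 1) = 0 := by
  simp only [fcA]
  obtain ⟨M, hM⟩ : ∃ M, k * (n + 1) = M + 1 := ⟨k * (n + 1) - 1, by
    have : 0 < k * (n + 1) := by positivity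
    omega⟩
  have h := Nat.add_one_mul_choose_eq M n
  rw [← hM] at h
  have h' : ((k * (n + 1) : ℕ) : ℝ) * (M.choose n : ℝ)
      = ((k * (n + 1)).choose (n + 1) : ℝ) * ((n + 1 : ℕ) : ℝ) := by exact_mod_cast h
  have e : k * (n + 1) + 0 - 1 = M := by omega
  rw [e, add_zero]
  have hn : ((n : ℝ) + 1) ≠ 0 := by positivity
  apply mul_right_cancel₀ hn
  push_cast at h'
  linarith

lemma fcA_one (k n : ℕ) (hk : 1 ≤ k) : fcA k 1 n = fussCatalanR k n := by
  rcases n with _ | n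
  · simp [fcA, fussCatalanR]
  · simp only [fcA, fussCatalanR, Nat.add_sub_cancel]
    have h := Nat.choose_succ_right_eq (k * (n + 1)) n
    have hle : n ≤ k * (n + 1) := by nlinarith
    have h' : ((k * (n + 1)).choose (n + 1) : ℝ) * ((n : ℝ) + 1)
        = ((k * (n + 1)).choose n : ℝ) * ((k : ℝ) * (n + 1) - n) := by
      have := congrArg (Nat.cast : ℕ → ℝ) h
      push_cast [Nat.cast_sub hle] at this
      exact this
    have hk' : (1 : ℝ) ≤ k := by exact_mod_cast hk
    have hpos : 0 < ((k : ℝ) - 1) * ((n + 1 : ℕ) : ℝ) + 1 := by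
      have : 0 ≤ ((k : ℝ) - 1) * ((n + 1 : ℕ) : ℝ) :=
        mul_nonneg (by linarith) (by positivity)
      linarith
    rw [eq_div_iff hpos.ne', Nat.choose_succ_succ]
    push_cast
    linear_combination ((k : ℝ) - 1) * h'

lemma fcA_nonneg (k : ℕ) (hk : 1 ≤ k) (n : ℕ) : ∀ r, 0 ≤ fcA k r n := by
  induction n with
  | zero => intro r; simp [fcA]
  | succ n ih =>
    intro r
    induction r with
    | zero => rw [fcA_zero k n hk]
    | succ r ihr => rw [fcA_rec k r n hk]; exact add_nonneg ihr (ih _)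

lemma fcA_unique (k : ℕ) (G H : ℕ → PowerSeries ℝ)
    (hG : ∀ r, G (r + 1) = G r + PowerSeries.X * G (r + k))
    (hH : ∀ r, H (r + 1) = H r + PowerSeries.X * H (r + k)) (h0 : G 0 = H 0) (n : ℕ) :
    ∀ r, PowerSeries.coeff n (G r) = PowerSeries.coeff n (H r) := by
  induction n with
  | zero =>
    intro r
    induction r with
    | zero => rw [h0]
    | succ r ihr => rw [hG, hH, map_add, map_add, ihr]; simp
  | succ n ih =>
    intro r
    induction r with
    | zero => rw [h0]
    | succ r ihr =>
      rw [hG, hH, map_add, map_add, ihr, PowerSeries.coeff_succ_X_mul,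
        PowerSeries.coeff_succ_X_mul, ih]

lemma fcP_rec (k r : ℕ) (hk : 1 ≤ k) : PowerSeries.mk (fcA k (r + 1)) =
    PowerSeries.mk (fcA k r) + PowerSeries.X * PowerSeries.mk (fcA k (r + k)) := by
  ext n
  rcases n with _ | n
  · simp [fcA]
  · rw [map_add, PowerSeries.coeff_succ_X_mul]
    simp only [PowerSeries.coeff_mk]
    exact fcA_rec k r n hk

lemma fcP_zero (k : ℕ) (hk : 1 ≤ k) : PowerSeries.mk (fcA k 0) = 1 := by
  ext n
  rcases n with _ | n
  · simp [fcA]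
  · simp [fcA_zero k n hk, PowerSeries.coeff_one]

lemma fcA_conv (k : ℕ) (hk : 1 ≤ k) (r s n : ℕ) :
    ∑ p ∈ Finset.HasAntidiagonal.antidiagonal n, fcA k r p.1 * fcA k s p.2 = fcA k (r + s) n := by
  have := fcA_unique k (fun r => PowerSeries.mk (fcA k r) * PowerSeries.mk (fcA k s))
    (fun r => PowerSeries.mk (fcA k (r + s)))
    (fun r => by simp only [fcP_rec k r hk]; ring)
    (fun r => by
      have e : r + 1 + s = r + s + 1 := by ring
      have e' : r + k + s = r + s + k := by ring
      simp only [e, e']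
      exact fcP_rec k (r + s) hk)
    (by simp [fcP_zero k hk]) n r
  simpa [PowerSeries.coeff_mul] using this

lemma zk_pos (k : ℕ) (hk : 2 ≤ k) : 0 < zk k := by
  have : (2 : ℝ) ≤ k := by exact_mod_cast hk
  have h1 : (0 : ℝ) < (k : ℝ) - 1 := by linarith
  unfold zk
  positivity

lemma zk_w (k : ℕ) (hk : 2 ≤ k) :
    (k : ℝ) * zk k * ((k : ℝ) / (k - 1)) ^ (k - 1) = 1 := by
  have : (2 : ℝ) ≤ k := by exact_mod_cast hk
  have h1 : (k : ℝ) - 1 ≠ 0 := by intro h; linarith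
  obtain ⟨j, rfl⟩ : ∃ j, k = j + 1 := ⟨k - 1, by omega⟩
  unfold zk
  simp only [Nat.add_sub_cancel, div_pow, pow_succ]
  have h2 : ((j + 1 : ℕ) : ℝ) ≠ 0 := by positivity
  field_simp

lemma zk_fix (k : ℕ) (hk : 2 ≤ k) :
    1 + zk k * ((k : ℝ) / (k - 1)) ^ k = (k : ℝ) / (k - 1) := by
  have : (2 : ℝ) ≤ k := by exact_mod_cast hk
  have h1 : (k : ℝ) - 1 ≠ 0 := by intro h; linarith
  have h2 : (k : ℝ) ≠ 0 := by intro h; linarith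
  have h := zk_w k hk
  have e : ((k : ℝ) / (k - 1)) ^ k = ((k : ℝ) / (k - 1)) ^ (k - 1) * ((k : ℝ) / (k - 1)) := by
    rw [← pow_succ]; congr 1; omega
  have h3 : zk k * ((k : ℝ) / (k - 1)) ^ (k - 1) = 1 / k := by
    rw [eq_div_iff h2]; linarith
  rw [e, ← mul_assoc, h3]
  field_simp
  ring

lemma fcA_partial (k : ℕ) (hk : 2 ≤ k) (N : ℕ) : ∀ r,
    ∑ n ∈ Finset.range N, fcA k r n * zk k ^ n ≤ ((k : ℝ) / (k - 1)) ^ r := by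
  have hk' : (2 : ℝ) ≤ k := by exact_mod_cast hk
  have hw : (0 : ℝ) ≤ (k : ℝ) / (k - 1) := div_nonneg (by linarith) (by linarith)
  induction N with
  | zero => intro r; simpa using pow_nonneg hw r
  | succ N ih =>
    intro r
    induction r with
    | zero =>
      rw [Finset.sum_range_succ']
      simp only [fcA_zero k _ (by omega : 1 ≤ k)]
      simp [fcA]
    | succ r ihr =>
      have e : ∑ n ∈ Finset.range (N + 1), fcA k (r + 1) n * zk k ^ n
          = ∑ n ∈ Finset.range (N + 1), fcA k r n * zk k ^ n
            + zk k * ∑ n ∈ Finset.range N, fcA k (r + k) n * zk k ^ n := by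
        rw [Finset.sum_range_succ', Finset.sum_range_succ' (fun n => fcA k r n * zk k ^ n),
          Finset.mul_sum, add_right_comm, ← Finset.sum_add_distrib]
        congr 1
        apply Finset.sum_congr rfl
        intro n _
        rw [fcA_rec k r n (by omega)]
        ring
      rw [e]
      calc _ ≤ ((k : ℝ) / (k - 1)) ^ r + zk k * ((k : ℝ) / (k - 1)) ^ (r + k) :=
            add_le_add ihr (mul_le_mul_of_nonneg_left (ih _) (zk_pos k hk).le)
        _ = ((k : ℝ) / (k - 1)) ^ r * (1 + zk k * ((k : ℝ) / (k - 1)) ^ k) := by ring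
        _ = _ := by rw [zk_fix k hk, pow_succ]

lemma fcA_summable (k : ℕ) (hk : 2 ≤ k) (r : ℕ) (z : ℂ) (hz : ‖z‖ ≤ zk k) :
    Summable fun n : ℕ => ‖(fcA k r n : ℂ) * z ^ n‖ := by
  have hA := fcA_nonneg k (by omega)
  have h0 : Summable fun n => fcA k r n * zk k ^ n :=
    summable_of_sum_range_le
      (fun n => mul_nonneg (hA n r) (pow_nonneg (zk_pos k hk).le n))
      (fun N => fcA_partial k hk N r)
  refine Summable.of_nonneg_of_le (fun n => norm_nonneg _) (fun n => ?_) h0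
  rw [norm_mul, norm_pow, Complex.norm_real, Real.norm_of_nonneg (hA n r)]
  exact mul_le_mul_of_nonneg_left (pow_le_pow_left₀ (norm_nonneg _) hz n) (hA n r)

/-- The sum of the series. -/
noncomputable def fcB (k r : ℕ) (z : ℂ) : ℂ := ∑' n : ℕ, (fcA k r n : ℂ) * z ^ n

lemma fcB_mul (k : ℕ) (hk : 2 ≤ k) (r s : ℕ) (z : ℂ) (hz : ‖z‖ ≤ zk k) :
    fcB k r z * fcB k s z = fcB k (r + s) z := by
  unfold fcB
  rw [tsum_mul_tsum_eq_tsum_sum_antidiagonal_of_summable_norm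
    (fcA_summable k hk r z hz) (fcA_summable k hk s z hz)]
  congr 1
  ext n
  rw [← fcA_conv k (by omega) r s n]
  push_cast
  rw [Finset.sum_mul]
  apply Finset.sum_congr rfl
  intro p hp
  rw [← Finset.HasAntidiagonal.mem_antidiagonal.mp hp, pow_add]
  ring

lemma fcB_zero (k : ℕ) (hk : 1 ≤ k) (z : ℂ) : fcB k 0 z = 1 := by
  unfold fcB
  rw [tsum_eq_single 0]
  · simp [fcA]
  · intro n hn
    obtain ⟨m, rfl⟩ := Nat.exists_eq_succ_of_ne_zero hn
    simp [fcA_zero k m hk]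

lemma fcB_pow (k : ℕ) (hk : 2 ≤ k) (r : ℕ) (z : ℂ) (hz : ‖z‖ ≤ zk k) :
    fcB k r z = fcB k 1 z ^ r := by
  induction r with
  | zero => simp [fcB_zero k (by omega)]
  | succ r ih => rw [pow_succ, ← ih, fcB_mul k hk r 1 z hz]

lemma fcB_one (k : ℕ) (hk : 1 ≤ k) (z : ℂ) : fcB k 1 z = Qc k z := by
  unfold fcB Qc
  simp only [fcA_one k _ hk]

lemma Qc_eq (k : ℕ) (hk : 2 ≤ k) (z : ℂ) (hz : ‖z‖ ≤ zk k) :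
    Qc k z = 1 + z * Qc k z ^ k := by
  have h1 : Qc k z ^ k = fcB k k z := by
    rw [← fcB_one k (by omega), fcB_pow k hk k z hz]
  rw [h1]
  rw [← fcB_one k (by omega)]
  have hs := (fcA_summable k hk 1 z hz).of_norm
  unfold fcB
  rw [hs.tsum_eq_zero_add, ← tsum_mul_left]
  congr 1
  · simp [fcA]
  · congr 1
    ext n
    have := fcA_rec k 0 n (by omega)
    rw [zero_add, zero_add, fcA_zero k n (by omega), zero_add] at this
    rw [this, pow_succ]
    ring

/-- The fixed-point equation at `z_k` has a unique positive solution. -/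
lemma fix_unique (k : ℕ) (hk : 2 ≤ k) (q : ℝ) (hq0 : 0 ≤ q)
    (hq : q = 1 + zk k * q ^ k) : q = (k : ℝ) / (k - 1) := by
  have hk' : (2 : ℝ) ≤ k := by exact_mod_cast hk
  have h1 : (0 : ℝ) < (k : ℝ) - 1 := by linarith
  have hw : (0 : ℝ) < (k : ℝ) / (k - 1) := div_pos (by linarith) h1
  set w := (k : ℝ) / (k - 1) with hwdef
  by_contra hne
  have ht : q / w ≠ 1 := by
    intro h; exact hne ((div_eq_one_iff_eq hw.ne').mp h)
  have hb := one_add_mul_self_lt_rpow_one_add (s := q / w - 1)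
    (by have := div_nonneg hq0 hw.le; linarith) (sub_ne_zero.mpr ht) (p := k) (by linarith)
  rw [add_sub_cancel, Real.rpow_natCast, div_pow] at hb
  have hzw : zk k * w ^ k = w - 1 := by linarith [zk_fix k hk]
  have hwk : 0 < w ^ k := pow_pos hw k
  rw [lt_div_iff₀ hwk] at hb
  have h2 := mul_lt_mul_of_pos_left hb (zk_pos k hk)
  have h3 : zk k * ((1 + k * (q / w - 1)) * w ^ k) = (1 + k * (q / w - 1)) * (w - 1) := by
    rw [← hzw]; ring
  have h4 : (1 + k * (q / w - 1)) * (w - 1) = q - 1 := by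
    rw [hwdef]
    have hkne : (k : ℝ) ≠ 0 := by linarith
    have := h1.ne'
    field_simp
    ring
  rw [h3, h4] at h2
  linarith

/-- For `k ≥ 3`, the series defining `Q` converges
absolutely on `|z| ≤ z_k`, and the only `z` with `|z| ≤ z_k` satisfying
`k z Q(z)^{k-1} = 1` is `z = z_k`. -/
theorem unique_root_on_closed_disk (k : ℕ) (hk : 3 ≤ k) :
    (∀ z : ℂ, ‖z‖ ≤ zk k →
        Summable fun n : ℕ => ‖(fussCatalanR k n : ℂ) * z ^ n‖) ∧
      ∀ z : ℂ, ‖z‖ ≤ zk k →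
        ((k : ℂ) * z * Qc k z ^ (k - 1) = 1 ↔ z = (zk k : ℂ)) := by
  refine ⟨fun z hz => ?_, fun z hz => ?_⟩
  · have := fcA_summable k (by omega) 1 z hz
    simpa only [fcA_one k _ (by omega : 1 ≤ k)] using this
  have hk2 : 2 ≤ k := by omega
  have hk' : (3 : ℝ) ≤ k := by exact_mod_cast hk
  have h1 : (k : ℝ) - 1 ≠ 0 := by intro h; linarith
  have hwne : ((k : ℝ) / (k - 1)) ≠ 0 := div_ne_zero (by linarith) h1
  have hc := zk_w k hk2
  have hcC : (k : ℂ) * (zk k : ℂ) * (((k : ℝ) / (k - 1) : ℝ) : ℂ) ^ (k - 1) = 1 := by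
    exact_mod_cast congrArg (Complex.ofReal) hc
  constructor
  · intro h
    have hQ := Qc_eq k hk2 z hz
    have e : Qc k z ^ k = Qc k z ^ (k - 1) * Qc k z := by
      rw [← pow_succ]; congr 1; omega
    have h1C : (k : ℂ) - 1 ≠ 0 := by exact_mod_cast h1
    have hq : Qc k z = (((k : ℝ) / (k - 1) : ℝ) : ℂ) := by
      push_cast
      rw [eq_div_iff h1C]
      rw [e] at hQ
      linear_combination (k : ℂ) * hQ + Qc k z * h
    rw [hq] at h
    have hkC : (k : ℂ) ≠ 0 := by
      have : k ≠ 0 := by omega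
      exact_mod_cast this
    have hwC : (((k : ℝ) / (k - 1) : ℝ) : ℂ) ^ (k - 1) ≠ 0 :=
      pow_ne_zero _ (by exact_mod_cast hwne)
    rw [← hcC] at h
    exact mul_left_cancel₀ hkC (mul_right_cancel₀ hwC h)
  · rintro rfl
    have hQ := Qc_eq k hk2 _ hz
    have hr : Qc k (zk k : ℂ) = ((∑' n : ℕ, fussCatalanR k n * zk k ^ n : ℝ) : ℂ) := by
      unfold Qc
      push_cast
      rfl
    have hq0 : 0 ≤ ∑' n : ℕ, fussCatalanR k n * zk k ^ n := by
      apply tsum_nonneg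
      intro n
      rw [← fcA_one k n (by omega)]
      exact mul_nonneg (fcA_nonneg k (by omega) n 1) (pow_nonneg (zk_pos k hk2).le n)
    rw [hr] at hQ ⊢
    rw [fix_unique k hk2 _ hq0 (by exact_mod_cast hQ)]
    exact hcC
end

section
/- Let k ≥ 3 and let a_n = (1/((k−1)n+1))·binom(kn, n) be the Fuss–Catalan numbers and z_k := (k−1)^{k−1}/k^k. Then a_n = √(k/(2π n³(k−1)³)) · z_k^{−n} · (1 + O(n^{−1})); that is, there exists a constant M > 0 such that for all n ≥ 1, | a_n · z_k^n · n^{3/2} · √(2π(k−1)³/k) − 1 | ≤ M/n. -/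
open Stirling Filter Topology in
/-- Upper Stirling bound for the Stirling sequence. -/
theorem stirling_upper (j : ℕ) (hj : 1 ≤ j) :
    stirlingSeq j * (1 - 1 / (12 * (j : ℝ))) ≤ Real.sqrt Real.pi := by
  obtain ⟨i, rfl⟩ : ∃ i, j = i + 1 := ⟨j - 1, by omega⟩
  have hmono : Monotone (fun n : ℕ =>
      Real.log (stirlingSeq (n + 1)) - 1 / (12 * ((n : ℝ) + 1))) := by
    refine monotone_nat_of_le_succ fun n => ?_
    have h := log_stirlingSeq_sdiff_le (n + 1)
    push_cast at h ⊢
    have e : (1 : ℝ) / (12 * (n + 1) * (n + 1 + 1))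
        = 1 / (12 * ((n : ℝ) + 1)) - 1 / (12 * ((n : ℝ) + 1 + 1)) := by
      field_simp
      ring
    rw [e] at h
    linarith
  have hpi : 0 < Real.sqrt Real.pi := Real.sqrt_pos.2 Real.pi_pos
  have ht : Tendsto (fun n : ℕ =>
      Real.log (stirlingSeq (n + 1)) - 1 / (12 * ((n : ℝ) + 1))) atTop
      (𝓝 (Real.log (Real.sqrt Real.pi) - 0)) := by
    refine Tendsto.sub ?_ ?_
    · exact ((Real.continuousAt_log hpi.ne').tendsto.comp
        (tendsto_stirlingSeq_sqrt_pi.comp (tendsto_add_atTop_nat 1)))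
    · have h := (tendsto_one_div_add_atTop_nhds_zero_nat (𝕜 := ℝ)).const_mul (1 / 12)
      rw [mul_zero] at h
      refine h.congr fun n => ?_
      field_simp
  have h := hmono.ge_of_tendsto ht i
  have hs := stirlingSeq'_pos i
  simp only [sub_zero] at h
  have h2 : Real.log (stirlingSeq (i + 1)) + (- (1 / (12 * ((i : ℝ) + 1))))
      ≤ Real.log (Real.sqrt Real.pi) := by linarith
  have h3 := Real.exp_le_exp.2 h2
  rw [Real.exp_add, Real.exp_log hs, Real.exp_log hpi] at h3
  have h4 := Real.add_one_le_exp (- (1 / (12 * ((i : ℝ) + 1))))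
  push_cast
  refine le_trans (mul_le_mul_of_nonneg_left ?_ hs.le) h3
  linarith

open Stirling in
theorem factorial_eq_stirlingSeq (j : ℕ) (hj : 1 ≤ j) :
    (j.factorial : ℝ) =
      stirlingSeq j * (Real.sqrt 2 * Real.sqrt j * ((j : ℝ) / Real.exp 1) ^ j) := by
  have : (0 : ℝ) < j := by exact_mod_cast hj
  rw [stirlingSeq, Real.sqrt_mul (by norm_num)]
  field_simp

open Stirling in
theorem fussCatalan_key (p n : ℕ) (hp : 1 ≤ p) (hn : 1 ≤ n) :
    fussCatalanR (p + 1) n * zk (p + 1) ^ n * (n : ℝ) ^ ((3 : ℝ) / 2) *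
          Real.sqrt (2 * Real.pi * (((p + 1 : ℕ) : ℝ) - 1) ^ 3 / ((p + 1 : ℕ) : ℝ)) =
    stirlingSeq ((p + 1) * n) * Real.sqrt Real.pi / (stirlingSeq (p * n) * stirlingSeq n)
      * ((p * n : ℝ) / (p * n + 1)) := by
  have hp0 : (0 : ℝ) < p := by exact_mod_cast hp
  have hn0 : (0 : ℝ) < n := by exact_mod_cast hn
  have hpn : 1 ≤ p * n := Nat.mul_pos hp hn
  have hkn : 1 ≤ (p + 1) * n := Nat.mul_pos (by omega) hn
  have hsub : (p + 1) * n - n = p * n := by rw [Nat.add_mul, one_mul, Nat.add_sub_cancel]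
  have hle : n ≤ (p + 1) * n := by nlinarith
  have hpos : ∀ j : ℕ, 1 ≤ j → 0 < stirlingSeq j := by
    intro j hj
    obtain ⟨i, rfl⟩ : ∃ i, j = i + 1 := ⟨j - 1, by omega⟩
    exact stirlingSeq'_pos i
  have h1 := hpos _ hpn
  have h2 := hpos _ hn
  have hr : (n : ℝ) ^ ((3 : ℝ) / 2) = n * Real.sqrt n := by
    rw [Real.sqrt_eq_rpow, show (3 : ℝ) / 2 = 1 + 1 / 2 by norm_num, Real.rpow_add hn0,
      Real.rpow_one]
  have hq : Real.sqrt (2 * Real.pi * (p : ℝ) ^ 3 / ((p : ℝ) + 1)) =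
      Real.sqrt 2 * Real.sqrt Real.pi * (p * Real.sqrt p) / Real.sqrt ((p : ℝ) + 1) := by
    rw [Real.sqrt_div (by positivity), Real.sqrt_mul (by positivity),
      Real.sqrt_mul (by positivity), show (p : ℝ) ^ 3 = p ^ 2 * p by ring,
      Real.sqrt_mul (by positivity), Real.sqrt_sq hp0.le]
  unfold fussCatalanR zk
  rw [Nat.cast_choose ℝ hle, hsub, factorial_eq_stirlingSeq _ hkn,
    factorial_eq_stirlingSeq _ hpn, factorial_eq_stirlingSeq _ hn, hr]
  push_cast
  rw [add_sub_cancel_right, hq, Real.sqrt_mul (by positivity),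
    Real.sqrt_mul (by positivity)]
  have e1 : (((p : ℝ) + 1) * n / Real.exp 1) ^ ((p + 1) * n) =
      (((p : ℝ) + 1) ^ (p + 1)) ^ n * ((n / Real.exp 1) ^ (p * n) * (n / Real.exp 1) ^ n) := by
    rw [mul_div_assoc, mul_pow, pow_mul, ← pow_add]
    congr 2
    ring
  have e2 : ((p : ℝ) * n / Real.exp 1) ^ (p * n) =
      ((p : ℝ) ^ p) ^ n * (n / Real.exp 1) ^ (p * n) := by
    rw [mul_div_assoc, mul_pow, pow_mul]
  rw [e1, e2, div_pow ((p : ℝ) ^ p)]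
  have g1 : 0 < ((n : ℝ) / Real.exp 1) ^ (p * n) := by positivity
  have g2 : 0 < ((n : ℝ) / Real.exp 1) ^ n := by positivity
  have g3 : 0 < ((p : ℝ) ^ p) ^ n := by positivity
  have g4 : 0 < (((p : ℝ) + 1) ^ (p + 1)) ^ n := by positivity
  have s1 : 0 < Real.sqrt ((p : ℝ) + 1) := by positivity
  have s2 : 0 < Real.sqrt (p : ℝ) := by positivity
  have s3 : 0 < Real.sqrt (n : ℝ) := by positivity
  have s4 : 0 < Real.sqrt 2 := by positivity
  generalize ((n : ℝ) / Real.exp 1) ^ (p * n) = A at *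
  generalize ((n : ℝ) / Real.exp 1) ^ n = B at *
  generalize ((p : ℝ) ^ p) ^ n = C at *
  generalize (((p : ℝ) + 1) ^ (p + 1)) ^ n = D at *
  generalize Real.sqrt ((p : ℝ) + 1) = S1 at *
  generalize Real.sqrt (p : ℝ) = S2 at *
  generalize Real.sqrt (n : ℝ) = S3 at *
  generalize Real.sqrt 2 = S4 at *
  field_simp

/-- Asymptotics of the Fuss–Catalan numbers:
`a_n = √(k/(2π n³ (k-1)³)) · z_k^{-n} · (1 + O(n⁻¹))`. -/
theorem fussCatalan_asymptotics (k : ℕ) (hk : 3 ≤ k) :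
    ∃ M : ℝ, 0 < M ∧ ∀ n : ℕ, 1 ≤ n →
      |fussCatalanR k n * zk k ^ n * (n : ℝ) ^ ((3 : ℝ) / 2) *
          Real.sqrt (2 * Real.pi * ((k : ℝ) - 1) ^ 3 / (k : ℝ)) - 1| ≤
        M / (n : ℝ) := by
  obtain ⟨p, rfl⟩ : ∃ p, k = p + 1 := ⟨k - 1, by omega⟩
  have hp : 1 ≤ p := by omega
  refine ⟨2, by norm_num, fun n hn => ?_⟩
  rw [fussCatalan_key p n hp hn]
  have hp1 : (1 : ℝ) ≤ p := by exact_mod_cast hp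
  have hn1 : (1 : ℝ) ≤ n := by exact_mod_cast hn
  have hpn : 1 ≤ p * n := Nat.mul_pos hp hn
  have hkn : 1 ≤ (p + 1) * n := Nat.mul_pos (by omega) hn
  have hpi : 0 < Real.sqrt Real.pi := Real.sqrt_pos.2 Real.pi_pos
  have lN := Stirling.sqrt_pi_le_stirlingSeq (n := (p + 1) * n) (by omega)
  have lm := Stirling.sqrt_pi_le_stirlingSeq (n := p * n) (by omega)
  have ln := Stirling.sqrt_pi_le_stirlingSeq (n := n) (by omega)
  have hup : ∀ j : ℕ, n ≤ j →
      Stirling.stirlingSeq j * (1 - 1 / (12 * (n : ℝ))) ≤ Real.sqrt Real.pi := by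
    intro j hj
    have hs := Stirling.sqrt_pi_le_stirlingSeq (n := j) (by omega)
    refine le_trans (mul_le_mul_of_nonneg_left ?_ (hpi.le.trans hs)) (stirling_upper j (by omega))
    have : (n : ℝ) ≤ j := by exact_mod_cast hj
    gcongr
  have uN := hup ((p + 1) * n) (by nlinarith)
  have um := hup (p * n) (by nlinarith)
  have un := hup n le_rfl
  have hx : 1 / (12 * (n : ℝ)) = (1 / n) / 12 := by field_simp
  have hy0 : 0 < 1 / (n : ℝ) := by positivity
  have hy1 : 1 / (n : ℝ) ≤ 1 := by rw [div_le_one (by positivity)]; exact hn1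
  have hmle : (n : ℝ) ≤ p * n := by nlinarith
  have hF1 : (p * n : ℝ) / (p * n + 1) ≤ 1 := by
    rw [div_le_one (by positivity)]; linarith
  have hF2 : 1 - 1 / (n : ℝ) ≤ (p * n : ℝ) / (p * n + 1) := by
    have : (p * n : ℝ) / (p * n + 1) = 1 - 1 / (p * n + 1) := by field_simp; ring
    rw [this]
    gcongr
    linarith
  rw [hx] at uN um un
  rw [show 2 / (n : ℝ) = 2 * (1 / n) by ring]
  generalize (p * n : ℝ) / (p * n + 1) = F at *
  generalize 1 / (n : ℝ) = y at *
  generalize Stirling.stirlingSeq ((p + 1) * n) = a at *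
  generalize Stirling.stirlingSeq (p * n) = b at *
  generalize Stirling.stirlingSeq n = c at *
  generalize Real.sqrt Real.pi = w at *
  have hb : 0 < b := hpi.trans_le lm
  have hc : 0 < c := hpi.trans_le ln
  have ha : 0 < a := hpi.trans_le lN
  have hF0 : 0 ≤ F := by linarith
  have hR0 : 0 ≤ a * w / (b * c) := by positivity
  have hy12 : 0 < 1 - y / 12 := by linarith
  -- upper bound on the ratio
  have hRu : a * w / (b * c) ≤ 1 + 2 * y := by
    rw [div_le_iff₀ (by positivity)]
    have t1 : a ≤ w * (1 + 2 * y) := by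
      have : a * 1 ≤ a * ((1 - y / 12) * (1 + 2 * y)) :=
        mul_le_mul_of_nonneg_left (by nlinarith) ha.le
      have : a * (1 - y / 12) * (1 + 2 * y) ≤ w * (1 + 2 * y) :=
        mul_le_mul_of_nonneg_right uN (by linarith)
      linarith
    have t2 : w * w ≤ b * c := mul_le_mul lm ln hpi.le hb.le
    calc a * w ≤ w * (1 + 2 * y) * w := mul_le_mul_of_nonneg_right t1 hpi.le
      _ = (1 + 2 * y) * (w * w) := by ring
      _ ≤ _ := mul_le_mul_of_nonneg_left t2 (by linarith)
  -- lower bound on the ratio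
  have hRl : (1 - y / 12) * (1 - y / 12) ≤ a * w / (b * c) := by
    rw [le_div_iff₀ (by positivity)]
    calc (1 - y / 12) * (1 - y / 12) * (b * c)
        = (b * (1 - y / 12)) * (c * (1 - y / 12)) := by ring
      _ ≤ w * w := mul_le_mul um un (by positivity) hpi.le
      _ ≤ a * w := mul_le_mul_of_nonneg_right lN hpi.le
  generalize a * w / (b * c) = R at *
  rw [abs_le]
  constructor
  · have : (1 - y / 12) * (1 - y / 12) * (1 - y) ≤ R * F :=
      mul_le_mul hRl hF2 (by linarith) hR0
    nlinarith [mul_nonneg hy0.le (sub_nonneg.2 hy1), sq_nonneg y]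
  · have : R * F ≤ R * 1 := mul_le_mul_of_nonneg_left hF1 hR0
    linarith
end
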